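/- arXiv:1003.0083 — 2 statements merged into one kernel-verified Lean document; each statement's English description precedes it below -/
import Mathlib

section
/- Let Q be an integer with 3 ≤ Q ≤ 7 and let A_{𝔾^{Q,2}} := A_{𝔾^Q} + P_{ℓ²(Z)} be the adjacency operator of the homogeneous Cayley tree of degree Q perturbed by one self-loop at each vertex of a fixed two-sided infinite geodesic Z. Then ‖A_{𝔾^{Q,2}}‖ = (3−√5)Q/2 + √5, and this value is strictly greater than 2√(Q−1). If instead Q > 7, then ‖A_{𝔾^{Q,2}}‖ = 2√(Q−1). -/
open Filter MeasureTheory Set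
open scoped Topology Classical ENNReal

noncomputable section

/-- The Hilbert space ℓ²(V) with complex coefficients. -/
abbrev L2 (V : Type) := lp (fun _ : V => ℂ) 2

/-- The coordinate (delta) vector at a vertex `x`. -/
def delta {V : Type} (x : V) : L2 V :=
  haveI := Classical.decEq V; lp.single 2 x 1

/-- The matrix entry `B_{x y} = (B δ_y)(x)` of a bounded operator on ℓ²(V). -/
def entry {V : Type} (B : L2 V →L[ℂ] L2 V) (x y : V) : ℂ :=
  (B (delta y) : ∀ _ : V, ℂ) x

/-- The resolvent `R_B(z) = (z·1 − B)⁻¹` (junk value if not invertible). -/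
def Res {V : Type} (B : L2 V →L[ℂ] L2 V) (z : ℂ) : L2 V →L[ℂ] L2 V :=
  Ring.inverse (z • (1 : L2 V →L[ℂ] L2 V) - B)

/-- The resolvent at a real point. -/
def ResR {V : Type} (B : L2 V →L[ℂ] L2 V) (l : ℝ) : L2 V →L[ℂ] L2 V :=
  Res B (l : ℂ)

/-- `G` is the homogeneous Cayley tree of degree `Q`: connected, acyclic,
and every vertex has exactly `Q` neighbours. -/
structure IsCayleyTree {V : Type} (G : SimpleGraph V) (Q : ℕ) : Prop where
  conn : G.Connected
  acyc : G.IsAcyclic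
  deg : ∀ v : V, (G.neighborSet v).ncard = Q

/-- `A` is the adjacency operator of the simple graph `G` on ℓ²(V). -/
def IsAdjacencyOp {V : Type} (G : SimpleGraph V) (A : L2 V →L[ℂ] L2 V) : Prop :=
  ∀ x y : V, entry A x y = if G.Adj x y then 1 else 0

/-- `P` assigns to each subset `S ⊆ V` the orthogonal projection of ℓ²(V) onto ℓ²(S). -/
def IsProjFamily {V : Type} (P : Set V → (L2 V →L[ℂ] L2 V)) : Prop :=
  ∀ (S : Set V) (f : L2 V) (x : V),
    (P S f : ∀ _ : V, ℂ) x = if x ∈ S then (f : ∀ _ : V, ℂ) x else 0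

/-- `S` is the vertex set of a connected subtree of `G` in which every vertex has
exactly `q` neighbours within `S` (a subtree of constant internal degree `q`). -/
def IsRegularSubtree {V : Type} (G : SimpleGraph V) (S : Set V) (q : ℕ) : Prop :=
  (G.induce S).Connected ∧ ∀ x ∈ S, {y : V | y ∈ S ∧ G.Adj x y}.ncard = q

/-- Distance from a vertex to a set of vertices. -/
def distToSet {V : Type} (G : SimpleGraph V) (x : V) (S : Set V) : ℕ :=
  sInf {n : ℕ | ∃ y ∈ S, G.dist x y = n}

/-- `a(λ)` of equation (4.2) of the paper, for the tree of degree `Q`. -/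
def aF (Q : ℕ) (l : ℝ) : ℝ :=
  l * (1 - Real.sqrt (1 - 4 * ((Q : ℝ) - 1) / l ^ 2)) / (2 * ((Q : ℝ) - 1))

/-- `μ(λ)` of equation (4.3) of the paper, for the tree of degree `Q`. -/
def muF (Q : ℕ) (l : ℝ) : ℝ :=
  l * (((Q : ℝ) - 2) + (Q : ℝ) * Real.sqrt (1 - 4 * ((Q : ℝ) - 1) / l ^ 2)) /
    (2 * ((Q : ℝ) - 1))

/-- `M` realizes the inverse, within the corner algebra `P·B(ℓ²)·P`, of the operator
`P − P T P` (that is, of `I_{ℓ²(S)} − S(λ)` when `T` is the resolvent and `P = P_{ℓ²(S)}`). -/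
def IsCornerInverse {V : Type} (P M T : L2 V →L[ℂ] L2 V) : Prop :=
  P ∘L M = M ∧ M ∘L P = M ∧
    M ∘L (P - P ∘L T ∘L P) = P ∧ (P - P ∘L T ∘L P) ∘L M = P

/-- Ratios of consecutive values of a positive function along an infinite chain exceed `ρ`: once
one of them is at most `ρ`, they decrease by at least `c / k` at every step. -/
theorem ratio_lower_bound {V : Type} (h : V → ℝ) (R : V → V → Prop) {k l c ρ : ℝ}
    (hk : 0 < k) (hc : 0 < c) (hbound : ∀ r, 0 < r → r ≤ ρ → l + c ≤ k * r + 1 / r)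
    (hstep : ∀ x y, R x y → 0 < h x → 0 < h y →
      ∃ y', R y y' ∧ 0 < h y' ∧ k * h y' + h x ≤ l * h y)
    {x y : V} (hxy : R x y) (hx : 0 < h x) (hy : 0 < h y) : ρ * h x < h y := by
  have key : ∀ n : ℕ, ∀ x y, R x y → 0 < h x → 0 < h y → h y / h x ≤ ρ →
      k * (h y / h x) < n * c → False := by
    intro n
    induction n with
    | zero =>
      intro x y _ hx hy _ hlt
      have : 0 < k * (h y / h x) := by positivity
      simp at hlt
      linarith
    | succ n ih =>
      intro x y hxy hx hy hle hlt
      obtain ⟨y', hyy', hy', hrec⟩ := hstep x y hxy hx hy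
      have h1 := hbound _ (div_pos hy hx) hle
      have h2 : k * (h y' / h y) + 1 / (h y / h x) ≤ l := by
        rw [one_div_div, ← mul_div_assoc, ← add_div, div_le_iff₀ hy]
        exact hrec
      have h3 : k * (h y' / h y) ≤ k * (h y / h x) - c := by linarith
      push_cast at hlt
      refine ih y y' hyy' hy hy' ?_ (by linarith)
      have h4 : h y' / h y ≤ h y / h x := le_of_mul_le_mul_left (by linarith) hk
      exact h4.trans hle
  by_contra! hle
  obtain ⟨n, hn⟩ := exists_nat_gt (k * (h y / h x) / c)
  exact key n x y hxy hx hy ((div_le_iff₀ hx).2 hle) ((div_lt_iff₀ hc).1 hn)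

/-- Schur test for the adjacency operator of a symmetric, locally finite relation. -/
theorem opNorm_le_of_supersolution {V : Type} (T : L2 V →L[ℂ] L2 V) (s : V → Finset V)
    (hT : ∀ (f : L2 V) (x : V), (T f : ∀ _ : V, ℂ) x = ∑ y ∈ s x, (f : ∀ _ : V, ℂ) y)
    (hs : ∀ x y, y ∈ s x ↔ x ∈ s y) (w : V → ℝ) (hw : ∀ x, 0 < w x) {l : ℝ} (hl : 0 ≤ l)
    (hsup : ∀ x, ∑ y ∈ s x, w y ≤ l * w x) : ‖T‖ ≤ l := by
  refine ContinuousLinearMap.opNorm_le_bound _ hl fun f => ?_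
  refine lp.norm_le_of_forall_sum_le (by norm_num) (by positivity) fun F => ?_
  have hrow : ∀ x, ‖(T f : ∀ _ : V, ℂ) x‖ ^ 2 ≤
      l * ∑ y ∈ s x, w x * (‖(f : ∀ _ : V, ℂ) y‖ ^ 2 / w y) := by
    intro x
    have h1 : ‖(T f : ∀ _ : V, ℂ) x‖ ≤ ∑ y ∈ s x, ‖(f : ∀ _ : V, ℂ) y‖ := by
      rw [hT]
      exact norm_sum_le _ _
    have h2 : (∑ y ∈ s x, ‖(f : ∀ _ : V, ℂ) y‖) ^ 2 ≤
        (∑ y ∈ s x, w y) * ∑ y ∈ s x, ‖(f : ∀ _ : V, ℂ) y‖ ^ 2 / w y := by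
      refine Finset.sum_sq_le_sum_mul_sum_of_sq_le_mul _ (fun y _ => (hw y).le)
        (fun y _ => div_nonneg (sq_nonneg _) (hw y).le) fun y _ => ?_
      have := (hw y).ne'
      apply le_of_eq
      field_simp
    have h3 : 0 ≤ ∑ y ∈ s x, ‖(f : ∀ _ : V, ℂ) y‖ ^ 2 / w y :=
      Finset.sum_nonneg fun y _ => div_nonneg (sq_nonneg _) (hw y).le
    calc _ ≤ (∑ y ∈ s x, ‖(f : ∀ _ : V, ℂ) y‖) ^ 2 := by gcongr
      _ ≤ _ := h2
      _ ≤ (l * w x) * ∑ y ∈ s x, ‖(f : ∀ _ : V, ℂ) y‖ ^ 2 / w y := by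
        gcongr
        exact hsup x
      _ = _ := by rw [← Finset.mul_sum, mul_assoc]
  have hcol : ∑ x ∈ F, ∑ y ∈ s x, w x * (‖(f : ∀ _ : V, ℂ) y‖ ^ 2 / w y) ≤ l * ‖f‖ ^ 2 := by
    rw [Finset.sum_comm' (t' := F.biUnion s) (s' := fun y => F.filter fun x => y ∈ s x)
      (by simp only [Finset.mem_biUnion, Finset.mem_filter]; tauto)]
    have hnorm : ∑ y ∈ F.biUnion s, ‖(f : ∀ _ : V, ℂ) y‖ ^ 2 ≤ ‖f‖ ^ 2 := by
      simpa using lp.sum_rpow_le_norm_rpow (p := 2) (by norm_num) f (F.biUnion s)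
    calc _ ≤ ∑ y ∈ F.biUnion s, l * ‖(f : ∀ _ : V, ℂ) y‖ ^ 2 := by
          refine Finset.sum_le_sum fun y _ => ?_
          rw [← Finset.sum_mul]
          have h1 : ∑ x ∈ F.filter (fun x => y ∈ s x), w x ≤ l * w y := by
            refine le_trans (Finset.sum_le_sum_of_subset_of_nonneg ?_ fun x _ _ => (hw x).le)
              (hsup y)
            intro x hx
            exact (hs x y).1 (Finset.mem_filter.1 hx).2
          calc _ ≤ l * w y * (‖(f : ∀ _ : V, ℂ) y‖ ^ 2 / w y) :=
                mul_le_mul_of_nonneg_right h1 (div_nonneg (sq_nonneg _) (hw y).le)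
            _ = _ := by
                have := (hw y).ne'
                field_simp
      _ ≤ _ := by
          rw [← Finset.mul_sum]
          gcongr
  have hsum : ∑ x ∈ F, ‖(T f : ∀ _ : V, ℂ) x‖ ^ 2 ≤ (l * ‖f‖) ^ 2 := by
    calc _ ≤ ∑ x ∈ F, l * ∑ y ∈ s x, w x * (‖(f : ∀ _ : V, ℂ) y‖ ^ 2 / w y) :=
          Finset.sum_le_sum fun x _ => hrow x
      _ ≤ l * (l * ‖f‖ ^ 2) := by
          rw [← Finset.mul_sum]
          gcongr
      _ = _ := by ring
  simpa using hsum

/-- Above the norm of the adjacency operator of a locally finite relation there is a nonnegative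
supersolution which is positive at a given vertex. -/
theorem exists_supersolution_of_opNorm_lt {V : Type} (T : L2 V →L[ℂ] L2 V) (s : V → Finset V)
    (hT : ∀ (f : L2 V) (x : V), (T f : ∀ _ : V, ℂ) x = ∑ y ∈ s x, (f : ∀ _ : V, ℂ) y)
    {l : ℝ} (hl : ‖T‖ < l) (o : V) :
    ∃ h : V → ℝ, (∀ x, 0 ≤ h x) ∧ 0 < h o ∧ ∀ x, ∑ y ∈ s x, h y ≤ l * h x := by
  have hl0 : 0 < l := (norm_nonneg T).trans_lt hl
  let p : ℕ → V → ℝ := fun n =>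
    Nat.rec (fun x => if x = o then 1 else 0) (fun _ q x => ∑ y ∈ s x, q y) n
  have hp0 : ∀ x, p 0 x = if x = o then 1 else 0 := fun _ => rfl
  have hp1 : ∀ n x, p (n + 1) x = ∑ y ∈ s x, p n y := fun _ _ => rfl
  have hpnn : ∀ n x, 0 ≤ p n x := by
    intro n
    induction n with
    | zero => intro x; rw [hp0]; split_ifs <;> norm_num
    | succ n ih => intro x; rw [hp1]; exact Finset.sum_nonneg fun y _ => ih y
  have hTpow : ∀ n, (T ^ (n + 1)) (delta o) = T ((T ^ n) (delta o)) := by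
    intro n
    rw [pow_succ']
    rfl
  have hpT : ∀ n x, (((T ^ n) (delta o) : L2 V) : ∀ _ : V, ℂ) x = Complex.ofReal (p n x) := by
    intro n
    induction n with
    | zero => intro x; rw [hp0]; simp [delta, Pi.single_apply, apply_ite Complex.ofReal]
    | succ n ih =>
      intro x
      rw [hTpow, hT, hp1, Complex.ofReal_sum]
      exact Finset.sum_congr rfl fun y _ => ih y
  have hnorm : ∀ n, ‖(T ^ n) (delta o)‖ ≤ ‖T‖ ^ n := by
    intro n
    induction n with
    | zero => simp [delta, lp.norm_single]
    | succ n ih =>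
      rw [hTpow, pow_succ']
      exact (T.le_opNorm _).trans (mul_le_mul_of_nonneg_left ih (norm_nonneg T))
  have hple : ∀ n x, p n x ≤ ‖T‖ ^ n := by
    intro n x
    have h1 := lp.norm_apply_le_norm (p := 2) (by norm_num) ((T ^ n) (delta o)) x
    rw [hpT, Complex.norm_real, Real.norm_of_nonneg (hpnn n x)] at h1
    exact h1.trans (hnorm n)
  have hsummable : ∀ x, Summable fun n => p n x / l ^ n := by
    intro x
    refine Summable.of_nonneg_of_le (fun n => div_nonneg (hpnn n x) (by positivity)) (fun n => ?_)
      (summable_geometric_of_lt_one (r := ‖T‖ / l) (by positivity) ((div_lt_one hl0).2 hl))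
    rw [div_pow]
    gcongr
    exact hple n x
  have hnn : ∀ x n, 0 ≤ p n x / l ^ n := fun x n => div_nonneg (hpnn n x) (by positivity)
  refine ⟨fun x => ∑' n, p n x / l ^ n, fun x => tsum_nonneg (hnn x), ?_, fun x => ?_⟩
  · have := (hsummable o).le_tsum 0 fun n _ => hnn o n
    simp only [hp0] at this
    norm_num at this
    linarith
  · beta_reduce
    rw [← Summable.tsum_finsetSum fun y _ => hsummable y, (hsummable x).tsum_eq_zero_add, mul_add,
      ← tsum_mul_left]
    have h1 : ∀ n, ∑ y ∈ s x, p n y / l ^ n = l * (p (n + 1) x / l ^ (n + 1)) := by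
      intro n
      rw [hp1, ← Finset.sum_div]
      field_simp
      ring
    simp only [h1]
    have := mul_nonneg hl0.le (hnn x 0)
    linarith

/-- The neighbourhoods of a homogeneous tree of positive degree, as finite sets. -/
theorem IsCayleyTree.exists_neighborFinset {V : Type} {G : SimpleGraph V} {Q : ℕ}
    (hG : IsCayleyTree G Q) (hQ : 0 < Q) :
    ∃ N : V → Finset V, (∀ x y, y ∈ N x ↔ G.Adj x y) ∧ ∀ x, (N x).card = Q := by
  have hfin : ∀ x, (G.neighborSet x).Finite := fun x =>
    Set.finite_of_ncard_pos (by rw [hG.deg x]; exact hQ)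
  refine ⟨fun x => (hfin x).toFinset, fun x y => by simp, fun x => ?_⟩
  rw [← Set.ncard_eq_toFinset_card _ (hfin x), hG.deg x]

theorem IsAdjacencyOp.apply_eq_sum {V : Type} {G : SimpleGraph V} {A : L2 V →L[ℂ] L2 V}
    (hA : IsAdjacencyOp G A) (hsa : IsSelfAdjoint A) {N : V → Finset V}
    (hN : ∀ x y, y ∈ N x ↔ G.Adj x y) (f : L2 V) (x : V) :
    (A f : ∀ _ : V, ℂ) x = ∑ y ∈ N x, (f : ∀ _ : V, ℂ) y := by
  have hinner : ∀ (g : L2 V) (y : V), inner ℂ (delta y) g = (g : ∀ _ : V, ℂ) y := by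
    intro g y
    rw [delta, lp.inner_single_left]
    simp
  have hAd : A (delta x) = ∑ y ∈ N x, delta y := by
    ext z
    have h1 := hA z x
    rw [entry] at h1
    rw [h1, lp.coeFn_sum, Finset.sum_apply]
    simp [delta, Pi.single_apply, hN, G.adj_comm]
  have hsymm : inner ℂ (delta x) (A f) = inner ℂ (A (delta x)) f :=
    (hsa.isSymmetric (delta x) f).symm
  rw [← hinner, hsymm, hAd, sum_inner]
  exact Finset.sum_congr rfl fun y _ => hinner f y

/-- The neighbourhoods in the graph with a loop added at each vertex of `Z`. -/
def loopNbhd {V : Type} (N : V → Finset V) (Z : Set V) (x : V) : Finset V :=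
  if x ∈ Z then insert x (N x) else N x

theorem sum_loopNbhd {V M : Type} [AddCommMonoid M] {N : V → Finset V} (hN : ∀ x, x ∉ N x)
    (Z : Set V) (g : V → M) (x : V) :
    ∑ y ∈ loopNbhd N Z x, g y = ∑ y ∈ N x, g y + if x ∈ Z then g x else 0 := by
  unfold loopNbhd
  split_ifs with h
  · rw [Finset.sum_insert (hN x), add_comm]
  · rw [add_zero]

theorem mem_loopNbhd_comm {V : Type} {N : V → Finset V} (hN : ∀ x y, y ∈ N x ↔ x ∈ N y)
    (Z : Set V) (x y : V) : y ∈ loopNbhd N Z x ↔ x ∈ loopNbhd N Z y := by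
  rcases eq_or_ne x y with rfl | hxy
  · rfl
  · have := hN x y
    unfold loopNbhd
    split_ifs <;> simp [hxy, hxy.symm, this]

section distToSet

variable {V : Type} {G : SimpleGraph V} {Z : Set V}

theorem distToSet_le {x z : V} (hz : z ∈ Z) : distToSet G x Z ≤ G.dist x z :=
  Nat.sInf_le ⟨z, hz, rfl⟩

theorem exists_dist_eq_distToSet (hZ : Z.Nonempty) (x : V) :
    ∃ z ∈ Z, G.dist x z = distToSet G x Z :=
  Nat.sInf_mem (s := {n : ℕ | ∃ y ∈ Z, G.dist x y = n}) (by
    obtain ⟨z, hz⟩ := hZ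
    exact ⟨_, z, hz, rfl⟩)

theorem distToSet_eq_zero_iff (hG : G.Connected) (hZ : Z.Nonempty) {x : V} :
    distToSet G x Z = 0 ↔ x ∈ Z := by
  constructor
  · intro h
    obtain ⟨z, hz, hxz⟩ := exists_dist_eq_distToSet (G := G) hZ x
    rw [h, hG.dist_eq_zero_iff] at hxz
    rwa [hxz]
  · intro h
    have := distToSet_le (G := G) (x := x) h
    simpa using this

theorem distToSet_le_add_one (hG : G.Connected) (hZ : Z.Nonempty) {x y : V} (hxy : G.Adj x y) :
    distToSet G x Z ≤ distToSet G y Z + 1 := by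
  obtain ⟨z, hz, hyz⟩ := exists_dist_eq_distToSet (G := G) hZ y
  have h1 := hG.dist_triangle (u := x) (v := y) (w := z)
  have h2 := distToSet_le (G := G) (x := x) hz
  rw [SimpleGraph.dist_eq_one_iff_adj.2 hxy] at h1
  omega

theorem exists_adj_distToSet_lt (hG : G.Connected) (hZ : Z.Nonempty) {x : V} (hx : x ∉ Z) :
    ∃ y, G.Adj x y ∧ distToSet G y Z < distToSet G x Z := by
  obtain ⟨z, hz, hxz⟩ := exists_dist_eq_distToSet (G := G) hZ x
  obtain ⟨p, hp⟩ := hG.exists_walk_length_eq_dist x z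
  cases p with
  | nil => exact absurd hz hx
  | @cons _ y _ h q =>
    refine ⟨y, h, ?_⟩
    have h1 := SimpleGraph.dist_le q
    have h2 := distToSet_le (G := G) (x := y) hz
    rw [SimpleGraph.Walk.length_cons] at hp
    have h3 := h2.trans h1
    omega

/-- In a tree, a vertex outside a connected set has at most one neighbour which is not farther
away from the set. -/
theorem eq_of_adj_of_distToSet_le (hG : G.Connected) (hacyc : G.IsAcyclic)
    (hZ : (G.induce Z).Connected) {x y₁ y₂ : V} (hx : x ∉ Z) (h₁ : G.Adj x y₁)
    (h₂ : G.Adj x y₂) (hd₁ : distToSet G y₁ Z ≤ distToSet G x Z)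
    (hd₂ : distToSet G y₂ Z ≤ distToSet G x Z) : y₁ = y₂ := by
  by_contra hne
  have hZne : Z.Nonempty := Set.nonempty_coe_sort.1 hZ.nonempty
  set H := G.deleteEdges {s(x, y₁)} with hH
  have hadj : ∀ u v, G.Adj u v → u ≠ x → v ≠ x → H.Adj u v := by
    intro u v huv hu hv
    rw [hH, SimpleGraph.deleteEdges_adj]
    refine ⟨huv, fun he => ?_⟩
    have hxe : x ∈ s(u, v) := by
      rw [Set.mem_singleton_iff.1 he]
      exact Sym2.mem_mk_left _ _
    rcases Sym2.mem_iff.1 hxe with h | h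
    · exact hu h.symm
    · exact hv h.symm
  have hreach : ∀ n v, distToSet G v Z = n → v ≠ x → n ≤ distToSet G x Z →
      ∃ z ∈ Z, H.Reachable v z := by
    intro n
    induction n using Nat.strong_induction_on with
    | _ n ih =>
      intro v hv hvx hn
      by_cases hvZ : v ∈ Z
      · exact ⟨v, hvZ, SimpleGraph.Reachable.refl v⟩
      · obtain ⟨u, hvu, hu⟩ := exists_adj_distToSet_lt hG hZne hvZ
        have hux : u ≠ x := by
          rintro rfl
          omega
        obtain ⟨z, hz, huz⟩ := ih _ (hv ▸ hu) u rfl hux (by omega)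
        exact ⟨z, hz, (hadj v u hvu hvx hux).reachable.trans huz⟩
  have hZZ : ∀ z ∈ Z, ∀ z' ∈ Z, H.Reachable z z' := by
    intro z hz z' hz'
    let φ : G.induce Z →g H :=
      ⟨fun v => v.1, fun {u v} huv => hadj u.1 v.1 huv (fun h => hx (h ▸ u.2))
        (fun h => hx (h ▸ v.2))⟩
    exact (hZ.preconnected ⟨z, hz⟩ ⟨z', hz'⟩).map φ
  obtain ⟨z₁, hz₁, hr₁⟩ := hreach _ y₁ rfl h₁.ne' hd₁
  obtain ⟨z₂, hz₂, hr₂⟩ := hreach _ y₂ rfl h₂.ne' hd₂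
  have hxy₂ : H.Adj x y₂ := by
    rw [hH, SimpleGraph.deleteEdges_adj]
    refine ⟨h₂, fun he => ?_⟩
    rcases Sym2.eq_iff.1 (Set.mem_singleton_iff.1 he) with h | h
    · exact hne h.2.symm
    · exact h₁.ne h.1
  have hbridge := SimpleGraph.isAcyclic_iff_forall_adj_isBridge.1 hacyc h₁
  rw [SimpleGraph.isBridge_iff] at hbridge
  exact hbridge (hxy₂.reachable.trans (hr₂.trans ((hZZ z₂ hz₂ z₁ hz₁).trans hr₁.symm)))

end distToSet

theorem IsRegularSubtree.card_filter_mem {V : Type} {G : SimpleGraph V} {Z : Set V} {q : ℕ}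
    (hZ : IsRegularSubtree G Z q) {N : V → Finset V} (hN : ∀ x y, y ∈ N x ↔ G.Adj x y)
    {x : V} (hx : x ∈ Z) : ((N x).filter (· ∈ Z)).card = q := by
  rw [← hZ.2 x hx, ← Set.ncard_coe_finset]
  congr 1
  ext y
  simp [hN, and_comm]

/-- On a homogeneous tree with loops along a geodesic `Z`, powers of the distance to `Z` form a
supersolution. -/
theorem sum_pow_distToSet_le {V : Type} {G : SimpleGraph V} {Q : ℕ} (hG : IsCayleyTree G Q)
    {Z : Set V} (hZ : IsRegularSubtree G Z 2) {N : V → Finset V}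
    (hN : ∀ x y, y ∈ N x ↔ G.Adj x y) (hcard : ∀ x, (N x).card = Q) {a : ℝ} (ha : 0 < a)
    (ha1 : a ≤ 1) (h3 : 3 ≤ 1 / a + a) (x : V) :
    ∑ y ∈ loopNbhd N Z x, a ^ distToSet G y Z ≤
      (1 / a + ((Q : ℝ) - 1) * a) * a ^ distToSet G x Z := by
  have hZne : Z.Nonempty := Set.nonempty_coe_sort.1 hZ.1.nonempty
  rw [sum_loopNbhd fun x hx => G.irrefl ((hN x x).1 hx)]
  by_cases hx : x ∈ Z
  · have hcZ := hZ.card_filter_mem hN hx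
    have hcZ' := Finset.card_filter_add_card_filter_not (s := N x) (· ∈ Z)
    rw [hcZ, hcard] at hcZ'
    have hcR : (((N x).filter (· ∉ Z)).card : ℝ) = (Q : ℝ) - 2 := by
      rw [← hcZ']
      push_cast
      ring
    rw [if_pos hx, (distToSet_eq_zero_iff hG.conn hZne).2 hx,
      ← Finset.sum_filter_add_sum_filter_not (N x) (· ∈ Z)]
    have h1 : ∑ y ∈ (N x).filter (· ∈ Z), a ^ distToSet G y Z ≤ 2 := by
      refine (Finset.sum_le_card_nsmul _ _ 1 fun y _ => pow_le_one₀ ha.le ha1).trans ?_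
      rw [hcZ]
      norm_num
    have h2 : ∑ y ∈ (N x).filter (· ∉ Z), a ^ distToSet G y Z ≤ ((Q : ℝ) - 2) * a := by
      refine (Finset.sum_le_card_nsmul _ _ a fun y hy => ?_).trans ?_
      · refine pow_le_of_le_one ha.le ha1 fun h => (Finset.mem_filter.1 hy).2 ?_
        exact (distToSet_eq_zero_iff hG.conn hZne).1 h
      · rw [nsmul_eq_mul, hcR]
    rw [pow_zero]
    linarith
  · rw [if_neg hx, add_zero]
    obtain ⟨u, hxu, hu⟩ := exists_adj_distToSet_lt hG.conn hZne hx
    have hmem : u ∈ N x := (hN x u).2 hxu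
    have hdu : distToSet G x Z = distToSet G u Z + 1 := by
      have := distToSet_le_add_one hG.conn hZne hxu
      omega
    rw [← Finset.add_sum_erase _ _ hmem]
    have h1 : ∑ y ∈ (N x).erase u, a ^ distToSet G y Z ≤
        ((Q : ℝ) - 1) * a ^ (distToSet G x Z + 1) := by
      refine (Finset.sum_le_card_nsmul _ _ (a ^ (distToSet G x Z + 1)) fun y hy => ?_).trans ?_
      · obtain ⟨hyu, hyN⟩ := Finset.mem_erase.1 hy
        refine pow_le_pow_of_le_one ha.le ha1 ?_
        by_contra! hlt
        exact hyu (eq_of_adj_of_distToSet_le hG.conn hG.acyc hZ.1 hx ((hN x y).1 hyN) hxu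
          (Nat.lt_succ_iff.1 hlt) hu.le)
      · rw [nsmul_eq_mul, Finset.cast_card_erase_of_mem hmem, hcard]
    rw [hdu] at h1 ⊢
    refine (add_le_add_right h1 _).trans (le_of_eq ?_)
    field_simp
    ring

/-- Above the values of `r ↦ k r + 1 / r` on `(0, ρ]`, a positive supersolution of a tree with
`k + 1` neighbours per vertex cannot shrink by a factor `ρ` across an edge. -/
theorem lt_of_adj_of_supersolution {V : Type} {N : V → Finset V}
    (hsymm : ∀ x y, y ∈ N x ↔ x ∈ N y) {Q : ℕ} (hQ : 2 ≤ Q) (hcard : ∀ x, (N x).card = Q)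
    {h : V → ℝ} (hnn : ∀ x, 0 ≤ h x) {l c ρ : ℝ} (hl : 0 < l)
    (hsup : ∀ x, ∑ y ∈ N x, h y ≤ l * h x) (hc : 0 < c)
    (hbound : ∀ r, 0 < r → r ≤ ρ → l + c ≤ ((Q : ℝ) - 1) * r + 1 / r)
    {x y : V} (hxy : y ∈ N x) (hx : 0 < h x) : 0 < h y ∧ ρ * h x < h y := by
  have hpos : ∀ x y, y ∈ N x → 0 < h x → 0 < h y := by
    intro x y hxy hx
    have h1 := (Finset.single_le_sum (fun u _ => hnn u) ((hsymm x y).1 hxy)).trans (hsup y)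
    exact pos_of_mul_pos_right (hx.trans_le h1) hl.le
  have hQ' : (2 : ℝ) ≤ Q := by exact_mod_cast hQ
  refine ⟨hpos x y hxy hx, ratio_lower_bound h (fun x y => y ∈ N x) (k := (Q : ℝ) - 1) (l := l)
    (by linarith) hc hbound (fun x y hxy hx hy => ?_) hxy hx (hpos x y hxy hx)⟩
  have hxN := (hsymm x y).1 hxy
  have hcE : ((N y).erase x).card = Q - 1 := by rw [Finset.card_erase_of_mem hxN, hcard]
  have hne : ((N y).erase x).Nonempty := by
    rw [← Finset.card_pos]
    omega
  obtain ⟨y', hy', hmin⟩ := Finset.exists_min_image _ h hne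
  have hy'N := (Finset.mem_erase.1 hy').2
  refine ⟨y', hy'N, hpos y y' hy'N hy, ?_⟩
  have h1 := Finset.card_nsmul_le_sum _ _ _ hmin
  rw [nsmul_eq_mul, Finset.cast_card_erase_of_mem hxN, hcard] at h1
  have h2 := hsup y
  rw [← Finset.add_sum_erase _ _ hxN] at h2
  linarith

/-- Upper bound for the norm from the supersolution with decay rate `a` away from `Z`. -/
theorem opNorm_le_of_decay_rate {V : Type} {G : SimpleGraph V} {Q : ℕ} (hQ : 1 ≤ Q)
    (hG : IsCayleyTree G Q) {Z : Set V} (hZ : IsRegularSubtree G Z 2) {N : V → Finset V}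
    (hN : ∀ x y, y ∈ N x ↔ G.Adj x y) (hcard : ∀ x, (N x).card = Q) (T : L2 V →L[ℂ] L2 V)
    (hT : ∀ (f : L2 V) (x : V),
      (T f : ∀ _ : V, ℂ) x = ∑ y ∈ loopNbhd N Z x, (f : ∀ _ : V, ℂ) y)
    {a : ℝ} (ha : 0 < a) (ha1 : a ≤ 1) (h3 : 3 ≤ 1 / a + a) :
    ‖T‖ ≤ 1 / a + ((Q : ℝ) - 1) * a := by
  have hQ' : (1 : ℝ) ≤ Q := by exact_mod_cast hQ
  have hl : 0 ≤ 1 / a + ((Q : ℝ) - 1) * a :=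
    add_nonneg (by positivity) (mul_nonneg (by linarith) ha.le)
  exact opNorm_le_of_supersolution T _ hT
    (mem_loopNbhd_comm (fun x y => by rw [hN, hN, G.adj_comm]) Z) _ (fun x => pow_pos ha _) hl
    (sum_pow_distToSet_le hG hZ hN hcard ha ha1 h3)

theorem two_sqrt_le_opNorm {V : Type} {G : SimpleGraph V} {Q : ℕ} (hQ : 2 ≤ Q) {Z : Set V}
    (hZ : Z.Nonempty) {N : V → Finset V} (hN : ∀ x y, y ∈ N x ↔ G.Adj x y)
    (hcard : ∀ x, (N x).card = Q) (T : L2 V →L[ℂ] L2 V)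
    (hT : ∀ (f : L2 V) (x : V),
      (T f : ∀ _ : V, ℂ) x = ∑ y ∈ loopNbhd N Z x, (f : ∀ _ : V, ℂ) y) :
    2 * Real.sqrt ((Q : ℝ) - 1) ≤ ‖T‖ := by
  by_contra! hlt
  obtain ⟨l, hTl, hl⟩ := exists_between hlt
  have hl0 : 0 < l := (norm_nonneg T).trans_lt hTl
  obtain ⟨o, -⟩ := hZ
  obtain ⟨h, hnn, ho, hsup⟩ := exists_supersolution_of_opNorm_lt T _ hT hTl o
  have hsup' : ∀ x, ∑ y ∈ N x, h y ≤ l * h x := by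
    intro x
    have h1 := hsup x
    rw [sum_loopNbhd fun x hx => G.irrefl ((hN x x).1 hx)] at h1
    have h2 : 0 ≤ if x ∈ Z then h x else 0 := by split_ifs <;> simp [hnn x]
    linarith
  have hQ' : (2 : ℝ) ≤ Q := by exact_mod_cast hQ
  have hsq : Real.sqrt ((Q : ℝ) - 1) ^ 2 = (Q : ℝ) - 1 := Real.sq_sqrt (by linarith)
  obtain ⟨y, hy⟩ : (N o).Nonempty := by
    rw [← Finset.card_pos, hcard]
    omega
  have key := lt_of_adj_of_supersolution (fun x y => by rw [hN, hN, G.adj_comm]) hQ hcard hnn hl0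
    hsup' (c := 2 * Real.sqrt ((Q : ℝ) - 1) - l) (ρ := h y / h o) (sub_pos.2 hl)
    (fun r hr _ => ?_) hy ho
  · rw [div_mul_cancel₀ _ ho.ne'] at key
    exact lt_irrefl _ key.2
  · have h1 : ((Q : ℝ) - 1) * r + 1 / r - 2 * Real.sqrt ((Q : ℝ) - 1) =
        (Real.sqrt ((Q : ℝ) - 1) * r - 1) ^ 2 / r := by
      rw [← hsq]
      field_simp
      rw [Real.sqrt_sq (Real.sqrt_nonneg _)]
      ring
    have h2 : 0 ≤ (Real.sqrt ((Q : ℝ) - 1) * r - 1) ^ 2 / r := by positivity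
    linarith

theorem decay_rate_le_opNorm {V : Type} {G : SimpleGraph V} {Q : ℕ} (hQ : 2 ≤ Q) {Z : Set V}
    (hZ : IsRegularSubtree G Z 2) {N : V → Finset V} (hN : ∀ x y, y ∈ N x ↔ G.Adj x y)
    (hcard : ∀ x, (N x).card = Q) (T : L2 V →L[ℂ] L2 V)
    (hT : ∀ (f : L2 V) (x : V),
      (T f : ∀ _ : V, ℂ) x = ∑ y ∈ loopNbhd N Z x, (f : ∀ _ : V, ℂ) y)
    {a : ℝ} (ha : 0 < a) (haQ : ((Q : ℝ) - 1) * a ^ 2 ≤ 1) (h3 : 1 / a + a = 3) :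
    1 / a + ((Q : ℝ) - 1) * a ≤ ‖T‖ := by
  by_contra! hlt
  obtain ⟨l, hTl, hl⟩ := exists_between hlt
  have hl0 : 0 < l := (norm_nonneg T).trans_lt hTl
  obtain ⟨o, ho⟩ : Z.Nonempty := Set.nonempty_coe_sort.1 hZ.1.nonempty
  obtain ⟨h, hnn, hpos, hsup⟩ := exists_supersolution_of_opNorm_lt T _ hT hTl o
  have hsup₀ : ∀ x, ∑ y ∈ N x, h y + (if x ∈ Z then h x else 0) ≤ l * h x := by
    intro x
    rw [← sum_loopNbhd fun x hx => G.irrefl ((hN x x).1 hx)]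
    exact hsup x
  have hsup' : ∀ x, ∑ y ∈ N x, h y ≤ l * h x := by
    intro x
    have h1 := hsup₀ x
    have h2 : 0 ≤ if x ∈ Z then h x else 0 := by split_ifs <;> simp [hnn x]
    linarith
  have hsymm : ∀ x y, y ∈ N x ↔ x ∈ N y := fun x y => by rw [hN, hN, G.adj_comm]
  have hQ' : (2 : ℝ) ≤ Q := by exact_mod_cast hQ
  have hbound : ∀ r, 0 < r → r ≤ a →
      l + (1 / a + ((Q : ℝ) - 1) * a - l) ≤ ((Q : ℝ) - 1) * r + 1 / r := by
    intro r hr hra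
    have h1 : ((Q : ℝ) - 1) * r + 1 / r - (1 / a + ((Q : ℝ) - 1) * a) =
        (a - r) * (1 - ((Q : ℝ) - 1) * (a * r)) / (a * r) := by
      field_simp
      ring
    have h2 : ((Q : ℝ) - 1) * (a * r) ≤ 1 := by
      refine le_trans (mul_le_mul_of_nonneg_left ?_ (by linarith)) haQ
      rw [sq]
      gcongr
    have h3 : 0 ≤ (a - r) * (1 - ((Q : ℝ) - 1) * (a * r)) / (a * r) :=
      div_nonneg (mul_nonneg (by linarith) (by linarith)) (by positivity)
    linarith
  have hedge : ∀ x y, y ∈ N x → 0 < h x → 0 < h y ∧ a * h x < h y := fun x y hxy hx =>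
    lt_of_adj_of_supersolution hsymm hQ hcard hnn hl0 hsup' (sub_pos.2 hl) hbound hxy hx
  have hstep : ∀ x y, (x ∈ Z ∧ y ∈ Z ∧ y ∈ N x) → 0 < h x → 0 < h y →
      ∃ y', (y ∈ Z ∧ y' ∈ Z ∧ y' ∈ N y) ∧ 0 < h y' ∧
        1 * h y' + h x ≤ (l - 1 - ((Q : ℝ) - 2) * a) * h y := by
    rintro x y ⟨hx, hy, hxy⟩ - hhy
    have hcZ := hZ.card_filter_mem hN hy
    have hxm : x ∈ (N y).filter (· ∈ Z) := Finset.mem_filter.2 ⟨(hsymm x y).1 hxy, hx⟩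
    obtain ⟨y', hy'⟩ : (((N y).filter (· ∈ Z)).erase x).Nonempty := by
      rw [← Finset.card_pos, Finset.card_erase_of_mem hxm, hcZ]
      norm_num
    obtain ⟨hyN, hyZ⟩ := Finset.mem_filter.1 (Finset.mem_erase.1 hy').2
    refine ⟨y', ⟨hy, hyZ, hyN⟩, (hedge y y' hyN hhy).1, ?_⟩
    have h1 := hsup₀ y
    rw [if_pos hy, ← Finset.sum_filter_add_sum_filter_not (N y) (· ∈ Z),
      ← Finset.add_sum_erase _ _ hxm] at h1
    have h2 := Finset.single_le_sum (fun u _ => hnn u) hy'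
    have hcZ' := Finset.card_filter_add_card_filter_not (s := N y) (· ∈ Z)
    rw [hcZ, hcard] at hcZ'
    have h4 : ((Q : ℝ) - 2) * (a * h y) ≤ ∑ u ∈ (N y).filter (· ∉ Z), h u := by
      have := Finset.card_nsmul_le_sum ((N y).filter (· ∉ Z)) h (a * h y) fun u hu =>
        (hedge y u (Finset.mem_filter.1 hu).1 hhy).2.le
      rw [nsmul_eq_mul] at this
      rw [← hcZ']
      push_cast
      linarith
    linarith
  have hcZ := hZ.card_filter_mem hN ho
  obtain ⟨y, hy⟩ : ((N o).filter (· ∈ Z)).Nonempty := by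
    rw [← Finset.card_pos, hcZ]
    norm_num
  obtain ⟨hyN, hyZ⟩ := Finset.mem_filter.1 hy
  have key := ratio_lower_bound h (fun x y => x ∈ Z ∧ y ∈ Z ∧ y ∈ N x) (k := 1)
    (l := l - 1 - ((Q : ℝ) - 2) * a) (c := 1 / a + ((Q : ℝ) - 1) * a - l) (ρ := h y / h o)
    one_pos (sub_pos.2 hl) (fun r hr _ => ?_) hstep ⟨ho, hyZ, hyN⟩ hpos (hedge o y hyN hpos).1
  · rw [div_mul_cancel₀ _ hpos.ne'] at key
    exact lt_irrefl _ key
  · have h1 : 1 * r + 1 / r - 2 = (r - 1) ^ 2 / r := by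
      field_simp
      ring
    have h2 : 0 ≤ (r - 1) ^ 2 / r := by positivity
    linarith

/-- **Section 4, equation (4.5).** For `3 ≤ Q ≤ 7`, the adjacency operator
`A_{𝔾^{Q,2}} = A + P_{ℓ²(Z)}` of the Cayley tree of degree `Q` perturbed by a self-loop at
each vertex of a two-sided infinite geodesic `Z` has norm `(3−√5)Q/2 + √5 > 2√(Q−1)`;
for `Q > 7` the norm is unchanged: `‖A_{𝔾^{Q,2}}‖ = 2√(Q−1)`. -/
theorem norm_geodesic_perturbation (Q : ℕ) (hQ : 3 ≤ Q)
    {V : Type} (G : SimpleGraph V) (hG : IsCayleyTree G Q)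
    (A : L2 V →L[ℂ] L2 V) (hA : IsAdjacencyOp G A) (hsa : IsSelfAdjoint A)
    (P : Set V → (L2 V →L[ℂ] L2 V)) (hP : IsProjFamily P)
    (Z : Set V) (hZ : IsRegularSubtree G Z 2) :
    (Q ≤ 7 →
      ‖A + P Z‖ = (3 - Real.sqrt 5) * (Q : ℝ) / 2 + Real.sqrt 5 ∧
      2 * Real.sqrt ((Q : ℝ) - 1) < (3 - Real.sqrt 5) * (Q : ℝ) / 2 + Real.sqrt 5)
    ∧ (7 < Q → ‖A + P Z‖ = 2 * Real.sqrt ((Q : ℝ) - 1)) := by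
  obtain ⟨N, hN, hcard⟩ := hG.exists_neighborFinset (by omega)
  have hT : ∀ (f : L2 V) (x : V),
      ((A + P Z) f : ∀ _ : V, ℂ) x = ∑ y ∈ loopNbhd N Z x, (f : ∀ _ : V, ℂ) y := by
    intro f x
    rw [sum_loopNbhd fun x hx => G.irrefl ((hN x x).1 hx), ← hA.apply_eq_sum hsa hN, ← hP]
    rfl
  have hQ' : (3 : ℝ) ≤ Q := by exact_mod_cast hQ
  constructor
  · intro hQ7
    have hQ7' : (Q : ℝ) ≤ 7 := by exact_mod_cast hQ7
    have h5 : Real.sqrt 5 ^ 2 = 5 := Real.sq_sqrt (by norm_num)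
    have h5nn := Real.sqrt_nonneg 5
    have h5lt : Real.sqrt 5 < 2.2361 := by
      rw [Real.sqrt_lt' (by norm_num)]
      norm_num
    have h5gt : 2.236 < Real.sqrt 5 := by
      rw [Real.lt_sqrt (by norm_num)]
      norm_num
    obtain ⟨a, ha⟩ : ∃ a, a = (3 - Real.sqrt 5) / 2 := ⟨_, rfl⟩
    have ha0 : 0 < a := by linarith
    have ha1 : a ≤ 1 := by linarith
    have hsq : a ^ 2 = 3 * a - 1 := by
      rw [ha]
      linarith
    have h3 : 1 / a + a = 3 := by
      field_simp
      linarith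
    have haQ : ((Q : ℝ) - 1) * a ^ 2 < 1 := by
      have h1 : ((Q : ℝ) - 1) * a ^ 2 ≤ 6 * a ^ 2 := by
        gcongr
        linarith
      linarith
    have hval : 1 / a + ((Q : ℝ) - 1) * a = (3 - Real.sqrt 5) * (Q : ℝ) / 2 + Real.sqrt 5 := by
      rw [eq_sub_of_add_eq h3, ha]
      ring
    rw [← hval]
    refine ⟨le_antisymm (opNorm_le_of_decay_rate (by omega) hG hZ hN hcard _ hT ha0 ha1 h3.ge)
      (decay_rate_le_opNorm (by omega) hZ hN hcard _ hT ha0 haQ.le h3), ?_⟩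
    have hs : Real.sqrt ((Q : ℝ) - 1) ^ 2 = (Q : ℝ) - 1 := Real.sq_sqrt (by linarith)
    have hne : Real.sqrt ((Q : ℝ) - 1) * a - 1 ≠ 0 := by
      intro h
      have h1 : (Real.sqrt ((Q : ℝ) - 1) * a) ^ 2 = 1 := by
        rw [sub_eq_zero.1 h, one_pow]
      rw [mul_pow, hs] at h1
      exact haQ.ne h1
    have h1 : 1 / a + ((Q : ℝ) - 1) * a - 2 * Real.sqrt ((Q : ℝ) - 1) =
        (Real.sqrt ((Q : ℝ) - 1) * a - 1) ^ 2 / a := by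
      field_simp
      rw [sub_sq, mul_pow, hs]
      ring
    have h2 : 0 < (Real.sqrt ((Q : ℝ) - 1) * a - 1) ^ 2 / a := by positivity
    linarith
  · intro hQ8
    have hQ8' : (8 : ℝ) ≤ Q := by exact_mod_cast hQ8
    have hs : Real.sqrt ((Q : ℝ) - 1) ^ 2 = (Q : ℝ) - 1 := Real.sq_sqrt (by linarith)
    have hs1 : 2.62 ≤ Real.sqrt ((Q : ℝ) - 1) := by
      refine Real.le_sqrt_of_sq_le ?_
      norm_num
      linarith
    set b := Real.sqrt ((Q : ℝ) - 1)
    have hb : 0 < b := by linarith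
    refine le_antisymm ?_
      (two_sqrt_le_opNorm (by omega) (Set.nonempty_coe_sort.1 hZ.1.nonempty) hN hcard _ hT)
    have h3 : 3 ≤ 1 / (1 / b) + 1 / b := by
      rw [one_div_one_div, ← sub_nonneg]
      have h1 : b + 1 / b - 3 = (b ^ 2 + 1 - 3 * b) / b := by
        field_simp
      rw [h1]
      exact div_nonneg (by nlinarith) hb.le
    refine (opNorm_le_of_decay_rate (by omega) hG hZ hN hcard _ hT (one_div_pos.2 hb)
      ((div_le_one hb).2 (by linarith)) h3).trans (le_of_eq ?_)
    rw [← hs]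
    field_simp
    ring
end
end

section
/- Let Q be an integer with 3 ≤ Q ≤ 7, λ* := ‖A_{𝔾^{Q,2}}‖ = (3−√5)Q/2 + √5, and S(λ) := P_{ℓ²(Z)} R_{A_{𝔾^Q}}(λ) restricted to ℓ²(Z). Then for every real λ > λ*, the operator I_{ℓ²(Z)} − S(λ) is invertible and R_{A_{𝔾^{Q,2}}}(λ) = R_{A_{𝔾^Q}}(λ)[ I + P_{ℓ²(Z)} (I_{ℓ²(Z)} − S(λ))^{-1} P_{ℓ²(Z)} R_{A_{𝔾^Q}}(λ) ]. Moreover, A_{𝔾^{Q,2}} is recurrent: lim_{λ ↓ λ*} ⟨R_{A_{𝔾^{Q,2}}}(λ) δ_0, δ_0⟩ = +∞, where 0 is any fixed vertex of Z. -/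
open Filter MeasureTheory Set
open scoped Topology Classical ENNReal

noncomputable section

/-- The resolvent identity for a perturbation by an idempotent, in a general ring. -/
lemma exists_cornerInverse_of_isUnit {R : Type*} [Ring R] {a p : R} (hp : p * p = p)
    (ha : IsUnit a) (hb : IsUnit (a - p)) :
    ∃ m : R, (p * m = m ∧ m * p = m ∧ m * (p - p * (Ring.inverse a * p)) = p ∧
      (p - p * (Ring.inverse a * p)) * m = p) ∧
      Ring.inverse (a - p) = Ring.inverse a * (1 + m * Ring.inverse a) := by
  obtain ⟨t, ht⟩ : ∃ t, t = Ring.inverse a := ⟨_, rfl⟩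
  obtain ⟨s, hs⟩ : ∃ s, s = Ring.inverse (a - p) := ⟨_, rfl⟩
  have hta : t * a = 1 := by rw [ht, Ring.inverse_mul_cancel _ ha]
  have hat : a * t = 1 := by rw [ht, Ring.mul_inverse_cancel _ ha]
  have hsa : s * (a - p) = 1 := by rw [hs, Ring.inverse_mul_cancel _ hb]
  have has : (a - p) * s = 1 := by rw [hs, Ring.mul_inverse_cancel _ hb]
  rw [← ht, ← hs]
  have h1 : s = t + t * p * s := by
    have : t * ((a - p) * s) = t := by rw [has, mul_one]
    have h2 : t * ((a - p) * s) = t * a * s - t * p * s := by noncomm_ring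
    rw [h2, hta, one_mul] at this
    exact sub_eq_iff_eq_add.1 this
  have h2 : s = t + s * p * t := by
    have : (s * (a - p)) * t = t := by rw [hsa, one_mul]
    have h3 : (s * (a - p)) * t = s * (a * t) - s * p * t := by noncomm_ring
    rw [h3, hat, mul_one] at this
    exact sub_eq_iff_eq_add.1 this
  have h1' : t * p * s = s - t := by rw [eq_sub_iff_add_eq, add_comm]; exact h1.symm
  have h2' : s * p * t = s - t := by rw [eq_sub_iff_add_eq, add_comm]; exact h2.symm
  refine ⟨p + p * s * p, ⟨?_, ?_, ?_, ?_⟩, ?_⟩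
  · rw [mul_add, hp, ← mul_assoc, ← mul_assoc, hp]
  · rw [add_mul, hp, mul_assoc, hp]
  · calc (p + p * s * p) * (p - p * (t * p))
        = p * p - (p * p) * t * p + p * s * (p * p) - p * s * (p * p) * t * p := by noncomm_ring
      _ = p - p * t * p + p * s * p - p * (s * p * t) * p := by rw [hp]; noncomm_ring
      _ = p := by rw [h2']; noncomm_ring
  · calc (p - p * (t * p)) * (p + p * s * p)
        = p * p - p * t * (p * p) + (p * p) * s * p - p * t * (p * p) * s * p := by noncomm_ring
      _ = p - p * t * p + p * s * p - p * (t * p * s) * p := by rw [hp]; noncomm_ring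
      _ = p := by rw [h1']; noncomm_ring
  · calc s = t + t * p * s := h1
      _ = t + t * p * (t + s * p * t) := by rw [← h2]
      _ = t * (1 + (p + p * s * p) * t) := by noncomm_ring

/-- If `a` and `p ≥ 0` are self-adjoint, then every real point above `‖a + p‖` lies in the
resolvent set of `a`. -/
lemma isUnit_smul_one_sub_of_norm_add_lt {R : Type*} [CStarAlgebra R] [PartialOrder R]
    [StarOrderedRing R] {a p : R} (ha : IsSelfAdjoint a) (hp : 0 ≤ p) {l : ℝ}
    (hl : ‖a + p‖ < l) :
    IsUnit ((l : ℂ) • (1 : R) - a) ∧ IsUnit ((l : ℂ) • (1 : R) - (a + p)) := by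
  have hsa : IsSelfAdjoint (a + p) := ha.add (IsSelfAdjoint.of_nonneg hp)
  have hl1 : (l : ℂ) • (1 : R) = algebraMap ℝ R l := by
    rw [Algebra.algebraMap_eq_smul_one, Complex.coe_smul]
  have h0 : algebraMap ℝ R (l - ‖a + p‖) ≤ algebraMap ℝ R l - (a + p) := by
    rw [map_sub]
    exact sub_le_sub_left hsa.le_algebraMap_norm_self _
  have h1 : algebraMap ℝ R (l - ‖a + p‖) ≤ algebraMap ℝ R l - a :=
    h0.trans (sub_le_sub_left (le_add_of_nonneg_right hp) _)
  have hpos : IsStrictlyPositive (algebraMap ℝ R (l - ‖a + p‖)) :=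
isStrictlyPositive_algebraMap (sub_pos.2 hl)
  rw [hl1]
  exact ⟨CStarAlgebra.isUnit_of_le _ h1 hpos, CStarAlgebra.isUnit_of_le _ h0 hpos⟩

/-- Restriction of functions to a subset is an idempotent. -/
lemma IsProjFamily.mul_self {V : Type} {P : Set V → (L2 V →L[ℂ] L2 V)} (hP : IsProjFamily P)
    (S : Set V) : P S * P S = P S := by
  ext f x
  rw [show (P S * P S) f = P S (P S f) from rfl, hP S, hP S]
  split_ifs <;> rfl

/-- Restriction of functions to a subset is a positive operator. -/
lemma IsProjFamily.nonneg {V : Type} {P : Set V → (L2 V →L[ℂ] L2 V)} (hP : IsProjFamily P)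
    (S : Set V) : 0 ≤ P S := by
  rw [ContinuousLinearMap.nonneg_iff_isPositive]
  refine ContinuousLinearMap.IsPositive.of_isStarProjection ⟨hP.mul_self S, ?_⟩
  rw [ContinuousLinearMap.isSelfAdjoint_iff_isSymmetric]
  intro f g
  rw [lp.inner_eq_tsum, lp.inner_eq_tsum]
  refine tsum_congr fun x => ?_
  have h1 := hP S f x
  have h2 := hP S g x
  simp only [ContinuousLinearMap.coe_coe]
  rw [h1, h2]
  split_ifs <;> simp

/-- A bounded operator on `ℓ²(V)` acts through its matrix entries. -/
lemma hasSum_entry {V : Type} (B : L2 V →L[ℂ] L2 V) (f : L2 V) (x : V) :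
    HasSum (fun y => (f : ∀ _ : V, ℂ) y * entry B x y) ((B f : ∀ _ : V, ℂ) x) := by
  have h := (lp.hasSum_single (E := fun _ : V => ℂ) (p := 2) (by norm_num) f).mapL
    ((lp.evalCLM ℂ (fun _ : V => ℂ) 2 x).comp B)
  have h2 : ∀ y, lp.single (E := fun _ : V => ℂ) 2 y ((f : ∀ _ : V, ℂ) y) =
      ((f : ∀ _ : V, ℂ) y) • delta y := by
    intro y
    rw [delta, ← lp.single_smul, smul_eq_mul, mul_one]
  simp only [h2, map_smul] at h
  exact h

lemma quadratic_root {D m : ℝ} (hm : 0 < m) (h : 4 * D < m ^ 2) :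
    0 < 2 / (m + √(m ^ 2 - 4 * D)) ∧ D * (2 / (m + √(m ^ 2 - 4 * D))) ^ 2 < 1 ∧
      1 / (2 / (m + √(m ^ 2 - 4 * D))) + D * (2 / (m + √(m ^ 2 - 4 * D))) = m ∧
      1 / (2 / (m + √(m ^ 2 - 4 * D))) - D * (2 / (m + √(m ^ 2 - 4 * D))) =
        √(m ^ 2 - 4 * D) := by
  have hs2 : √(m ^ 2 - 4 * D) ^ 2 = m ^ 2 - 4 * D := Real.sq_sqrt (by linarith)
  have hs0 : 0 ≤ √(m ^ 2 - 4 * D) := Real.sqrt_nonneg _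
  generalize √(m ^ 2 - 4 * D) = s at *
  have hms : 0 < m + s := by linarith
  refine ⟨by positivity, ?_, ?_, ?_⟩
  · rw [div_pow, mul_div_assoc', div_lt_one (by positivity)]
    nlinarith
  · field_simp
    nlinarith
  · field_simp
    nlinarith

/-- In a tree rooted at `r`, every other vertex has a unique neighbour closer to the root. -/
lemma exists_parent {V : Type} {G : SimpleGraph V} (hc : G.Connected) (ha : G.IsAcyclic) (r : V) :
    ∃ par : V → V, ∀ x, (x ≠ r → G.Adj x (par x) ∧ G.dist r (par x) + 1 = G.dist r x) ∧
      ∀ y, G.Adj x y → G.dist r y + 1 = G.dist r x → y = par x := by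
  choose p hp hpd using hc.exists_path_of_dist r
  refine ⟨fun x => (p x).penultimate, fun x => ⟨fun hx => ?_, fun y hxy hd => ?_⟩⟩
  · have hnil : ¬ (p x).Nil := SimpleGraph.Walk.not_nil_of_ne hx.symm
    have hadj := (p x).adj_penultimate hnil
    refine ⟨hadj.symm, ?_⟩
    have h1 : G.dist r (p x).penultimate ≤ (p x).dropLast.length := SimpleGraph.dist_le _
    have h2 : (p x).dropLast.length + 1 = (p x).length :=
      SimpleGraph.Walk.length_dropLast_add_one hnil
    have h3 := hpd x
    rcases SimpleGraph.IsTree.dist_eq_dist_add_one_of_adj ⟨hc, ha⟩ r hadj with h | h <;>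
      grind
  · have hw : ((p y).concat hxy.symm).length = G.dist r x := by
      rw [SimpleGraph.Walk.length_concat, hpd, hd]
    have hpath := SimpleGraph.Walk.isPath_of_length_eq_dist _ hw
    have h3 : (p y).concat hxy.symm = p x :=
      congrArg Subtype.val ((ha.subsingleton_path r x).elim ⟨_, hpath⟩ ⟨_, hp x⟩)
    simp only [← h3, SimpleGraph.Walk.penultimate_concat]

/-- A connected induced subtree containing the root contains the neighbours, closer to the root,
of its vertices. -/
lemma mem_of_adj_of_dist {V : Type} {G : SimpleGraph V} (hc : G.Connected) (ha : G.IsAcyclic)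
    {Z : Set V} (hZ : (G.induce Z).Connected) {r x y : V} (hr : r ∈ Z) (hx : x ∈ Z)
    (hxy : G.Adj x y) (hd : G.dist r y + 1 = G.dist r x) : y ∈ Z := by
  obtain ⟨q, hq, hqZ⟩ : ∃ q : G.Walk r x, q.IsPath ∧ ∀ z ∈ q.support, z ∈ Z := by
    obtain ⟨q, hq⟩ := (hZ.preconnected ⟨r, hr⟩ ⟨x, hx⟩).exists_isPath
    let f := (SimpleGraph.Embedding.induce (G := G) Z).toHom
    have h : ∃ q : G.Walk (f ⟨r, hr⟩) (f ⟨x, hx⟩), q.IsPath ∧ ∀ z ∈ q.support, z ∈ Z := by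
      refine ⟨q.map f, SimpleGraph.Walk.IsPath.map Subtype.val_injective hq, fun z hz => ?_⟩
      rw [SimpleGraph.Walk.support_map, List.mem_map] at hz
      obtain ⟨w, -, rfl⟩ := hz
      exact w.2
    exact h
  obtain ⟨p, -, hpd⟩ := hc.exists_path_of_dist r y
  have hw : (p.concat hxy.symm).length = G.dist r x := by
    rw [SimpleGraph.Walk.length_concat, hpd, hd]
  have hpath := SimpleGraph.Walk.isPath_of_length_eq_dist _ hw
  have h3 : p.concat hxy.symm = q :=
    congrArg Subtype.val ((ha.subsingleton_path r x).elim ⟨_, hpath⟩ ⟨_, hq⟩)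
  refine hqZ y ?_
  rw [← h3]
  exact p.support_subset_support_concat _ p.end_mem_support

/-- A tree rooted at a vertex `root`, described by its parent map and its finite sets
of children. -/
structure Rooting {V : Type} (G : SimpleGraph V) (root : V) where
  /-- The neighbour closer to the root. -/
  par : V → V
  /-- The neighbours farther from the root. -/
  children : V → Finset V
  /-- The distance to the root. -/
  depth : V → ℕ
  depth_eq_zero_iff : ∀ x, depth x = 0 ↔ x = root
  par_mem : ∀ x, x ≠ root → x ∈ children (par x)
  par_eq : ∀ x, ∀ y ∈ children x, par y = x
  depth_child : ∀ x, ∀ y ∈ children x, depth y = depth x + 1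
  adj_iff : ∀ x y, G.Adj x y ↔ y ∈ children x ∨ (x ≠ root ∧ y = par x)

namespace Rooting

variable {V : Type} {G : SimpleGraph V} {root : V}

lemma depth_root (T : Rooting G root) : T.depth root = 0 := (T.depth_eq_zero_iff root).2 rfl

lemma ne_root (T : Rooting G root) {x y : V} (h : y ∈ T.children x) : y ≠ root := by
  rintro rfl
  have := T.depth_child x _ h
  rw [T.depth_root] at this
  omega

lemma par_notMem_children (T : Rooting G root) {x : V} (hx : x ≠ root) :
    T.par x ∉ T.children x := by
  intro h
  have h1 := T.depth_child _ _ h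
  have h2 := T.depth_child _ _ (T.par_mem x hx)
  omega

/-- The multiplicative weight on the vertices whose ratio from parent to child is given by `g` at
the child. -/
def weight (T : Rooting G root) (g : V → ℝ) (x : V) : ℝ :=
  ∏ i ∈ Finset.range (T.depth x), g (T.par^[i] x)

lemma weight_root (T : Rooting G root) (g : V → ℝ) : T.weight g root = 1 := by
  simp [weight, T.depth_root]

lemma weight_child (T : Rooting G root) (g : V → ℝ) {x y : V} (h : y ∈ T.children x) :
    T.weight g y = g y * T.weight g x := by
  rw [weight, T.depth_child x y h, Finset.prod_range_succ', mul_comm]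
  simp [weight, Function.iterate_succ_apply, T.par_eq x y h]

/-- The vertices at distance `n` from the root. -/
def level (T : Rooting G root) : ℕ → Finset V
  | 0 => {root}
  | n + 1 => (T.level n).biUnion T.children

lemma mem_level (T : Rooting G root) (x : V) :
    x ∈ T.level (T.depth x) := by
  obtain ⟨n, hn⟩ : ∃ n, n = T.depth x := ⟨_, rfl⟩
  rw [← hn]
  induction n generalizing x with
  | zero => simp [level, (T.depth_eq_zero_iff x).1 hn.symm]
  | succ n ih =>
    have hx : x ≠ root := by
      rintro rfl
      rw [T.depth_root] at hn
      omega
    have h := T.par_mem x hx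
    have h2 := T.depth_child _ _ h
    exact Finset.mem_biUnion.2 ⟨_, ih _ (by omega), h⟩

lemma depth_of_mem_level (T : Rooting G root) {n : ℕ} {x : V} (h : x ∈ T.level n) :
    T.depth x = n := by
  induction n generalizing x with
  | zero => rw [Finset.mem_singleton.1 h, T.depth_root]
  | succ n ih =>
    obtain ⟨y, hy, hx⟩ := Finset.mem_biUnion.1 h
    rw [T.depth_child _ _ hx, ih hy]

lemma ne_root_of_mem_level (T : Rooting G root) {n : ℕ} {x : V} (h : x ∈ T.level (n + 1)) :
    x ≠ root := by
  obtain ⟨y, -, hy⟩ := Finset.mem_biUnion.1 h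
  exact T.ne_root hy

/-- A nonnegative function whose sum over the children of any vertex other than the root is at most
`θ < 1` times its value at that vertex is summable. -/
lemma summable_of_sum_children_le (T : Rooting G root)
    {w : V → ℝ} (hw : ∀ x, 0 ≤ w x) {θ : ℝ} (hθ0 : 0 ≤ θ) (hθ1 : θ < 1)
    (h : ∀ x, x ≠ root → ∑ y ∈ T.children x, w y ≤ θ * w x) : Summable w := by
  have hsucc : ∀ n, ∑ y ∈ T.level (n + 1), w y ≤ ∑ x ∈ T.level n, ∑ y ∈ T.children x, w y := by
    intro n
    rw [level, Finset.sum_biUnion]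
    intro a _ b _ hab
    refine Finset.disjoint_left.2 fun y hya hyb => hab ?_
    rw [← T.par_eq a y hya, T.par_eq b y hyb]
  have hgeom : ∀ n, ∑ y ∈ T.level (n + 1), w y ≤ θ ^ n * ∑ y ∈ T.level 1, w y := by
    intro n
    induction n with
    | zero => simp
    | succ n ih =>
      calc ∑ y ∈ T.level (n + 1 + 1), w y
          ≤ ∑ x ∈ T.level (n + 1), ∑ y ∈ T.children x, w y := hsucc _
        _ ≤ ∑ x ∈ T.level (n + 1), θ * w x :=
            Finset.sum_le_sum fun x hx => h x (T.ne_root_of_mem_level hx)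
        _ = θ * ∑ x ∈ T.level (n + 1), w x := by rw [Finset.mul_sum]
        _ ≤ θ * (θ ^ n * ∑ y ∈ T.level 1, w y) := mul_le_mul_of_nonneg_left ih hθ0
        _ = θ ^ (n + 1) * ∑ y ∈ T.level 1, w y := by ring
  have hlev : Summable fun n => ∑ y ∈ T.level n, w y := by
    rw [← summable_nat_add_iff 1]
    exact Summable.of_nonneg_of_le (fun n => Finset.sum_nonneg fun x _ => hw x) hgeom
      ((summable_geometric_of_lt_one hθ0 hθ1).mul_right _)
  refine summable_of_sum_le hw (c := ∑' n, ∑ y ∈ T.level n, w y) fun s => ?_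
  calc ∑ x ∈ s, w x
      ≤ ∑ x ∈ (s.image T.depth).biUnion T.level, w x :=
        Finset.sum_le_sum_of_subset_of_nonneg
          (fun x hx => Finset.mem_biUnion.2
            ⟨_, Finset.mem_image_of_mem _ hx, T.mem_level x⟩) fun x _ _ => hw x
    _ = ∑ n ∈ s.image T.depth, ∑ x ∈ T.level n, w x :=
        Finset.sum_biUnion fun a _ b _ hab => Finset.disjoint_left.2 fun y ha hb =>
          hab ((T.depth_of_mem_level ha).symm.trans (T.depth_of_mem_level hb))
    _ ≤ ∑' n, ∑ y ∈ T.level n, w y :=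
        hlev.sum_le_tsum _ fun n _ => Finset.sum_nonneg fun x _ => hw x

/-- The sum over the neighbours of a vertex. -/
lemma hasSum_adj (T : Rooting G root) (φ : V → ℂ) (x : V) :
    HasSum (fun y => φ y * (if G.Adj x y then 1 else 0))
      (∑ y ∈ T.children x, φ y + if x = root then 0 else φ (T.par x)) := by
  by_cases hx : x = root
  · rw [if_pos hx, add_zero]
    have h : ∀ y ∈ T.children x, φ y = φ y * (if G.Adj x y then 1 else 0) := fun y hy => by
      rw [if_pos ((T.adj_iff x y).2 (Or.inl hy)), mul_one]
    rw [Finset.sum_congr rfl h]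
    refine hasSum_sum_of_ne_finset_zero fun y hy => ?_
    rw [if_neg, mul_zero]
    rw [T.adj_iff]
    tauto
  · rw [if_neg hx, add_comm, ← Finset.sum_insert (T.par_notMem_children hx)]
    have h : ∀ y ∈ insert (T.par x) (T.children x),
        φ y = φ y * (if G.Adj x y then 1 else 0) := fun y hy => by
      rw [Finset.mem_insert] at hy
      rw [if_pos ((T.adj_iff x y).2 (by tauto)), mul_one]
    rw [Finset.sum_congr rfl h]
    refine hasSum_sum_of_ne_finset_zero fun y hy => ?_
    rw [Finset.mem_insert] at hy
    rw [if_neg, mul_zero]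
    rw [T.adj_iff]
    tauto

end Rooting

/-- A two-sided geodesic `Z` in the homogeneous tree of degree `Q`, rooted at a vertex of `Z`: the
root has two children in `Z`, the other vertices of `Z` have one, and the vertices off `Z` have
none. -/
lemma IsCayleyTree.exists_rooting {Q : ℕ} (hQ : 3 ≤ Q) {V : Type} {G : SimpleGraph V}
    (hG : IsCayleyTree G Q) {Z : Set V} (hZ : IsRegularSubtree G Z 2) {z0 : V} (hz0 : z0 ∈ Z) :
    ∃ T : Rooting G z0, ∀ (p q : ℝ) (x : V),
      ∑ y ∈ T.children x, (if y ∈ Z then p else q) =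
        if x = z0 then 2 * p + (Q - 2) * q
        else if x ∈ Z then p + (Q - 2) * q else (Q - 1) * q := by
  obtain ⟨par, hpar⟩ := exists_parent hG.conn hG.acyc z0
  have hfin : ∀ x, (G.neighborSet x).Finite := fun x =>
    Set.finite_of_ncard_ne_zero (by rw [hG.deg]; omega)
  let N : V → Finset V := fun x => (hfin x).toFinset
  have hN : ∀ x y, y ∈ N x ↔ G.Adj x y := fun x y => by simp [N]
  have hcard : ∀ x, (N x).card = Q := fun x => by
    rw [← hG.deg x, Set.ncard_eq_toFinset_card _ (hfin x)]
  have hcardZ : ∀ x ∈ Z, ((N x).filter (· ∈ Z)).card = 2 := fun x hx => by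
    rw [← hZ.2 x hx, ← Set.ncard_coe_finset]
    congr 1
    ext y
    simp [hN, and_comm]
  let ch : V → Finset V := fun x => (N x).filter fun y => G.dist z0 y = G.dist z0 x + 1
  have hch : ∀ x y, y ∈ ch x ↔ G.Adj x y ∧ G.dist z0 y = G.dist z0 x + 1 := fun x y => by
    rw [Finset.mem_filter, hN]
  have hadj : ∀ x y, G.Adj x y →
      G.dist z0 x = G.dist z0 y + 1 ∨ G.dist z0 y = G.dist z0 x + 1 := fun x y h =>
    SimpleGraph.IsTree.dist_eq_dist_add_one_of_adj ⟨hG.conn, hG.acyc⟩ z0 h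
  have hdist : ∀ x, G.dist z0 x = 0 ↔ x = z0 := fun x => by
    rw [hG.conn.dist_eq_zero_iff, eq_comm]
  let T : Rooting G z0 :=
    { par := par
      children := ch
      depth := G.dist z0
      depth_eq_zero_iff := hdist
      par_mem := fun x hx => (hch _ _).2
        ⟨((hpar x).1 hx).1.symm, ((hpar x).1 hx).2.symm⟩
      par_eq := fun x y hy => by
        rw [hch] at hy
        exact ((hpar y).2 x hy.1.symm hy.2.symm).symm
      depth_child := fun x y hy => ((hch x y).1 hy).2
      adj_iff := fun x y => by
        constructor
        · intro h
          rcases hadj x y h with h1 | h1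
          · refine Or.inr ⟨?_, (hpar x).2 y h h1.symm⟩
            intro hx
            rw [(hdist x).2 hx] at h1
            omega
          · exact Or.inl ((hch x y).2 ⟨h, h1⟩)
        · rintro (h | ⟨h, rfl⟩)
          · exact ((hch x y).1 h).1
          · exact ((hpar x).1 h).1 }
  have hNroot : N z0 = T.children z0 := by
    ext y
    rw [hN, T.adj_iff]
    tauto
  have hNx : ∀ x, x ≠ z0 → N x = insert (T.par x) (T.children x) := fun x hx => by
    ext y
    rw [hN, T.adj_iff, Finset.mem_insert]
    tauto
  have hparZ : ∀ x ∈ Z, x ≠ z0 → T.par x ∈ Z := fun x hx hx0 =>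
    mem_of_adj_of_dist hG.conn hG.acyc hZ.1 hz0 hx ((hpar x).1 hx0).1 ((hpar x).1 hx0).2
  have hchZ : ∀ x, x ∉ Z → ∀ y ∈ T.children x, y ∉ Z := fun x hx y hy hyZ =>
    hx (mem_of_adj_of_dist hG.conn hG.acyc hZ.1 hz0 hyZ ((hch x y).1 hy).1.symm
      ((hch x y).1 hy).2.symm)
  have hsum : ∀ (s : Finset V) (p q : ℝ), ∑ y ∈ s, (if y ∈ Z then p else q) =
      (s.filter (· ∈ Z)).card * p + (s.card - (s.filter (· ∈ Z)).card) * q := by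
    intro s p q
    rw [Finset.sum_ite, Finset.sum_const, Finset.sum_const, nsmul_eq_mul, nsmul_eq_mul,
      ← Finset.card_filter_add_card_filter_not (s := s) (· ∈ Z)]
    push_cast
    ring
  refine ⟨T, fun p q x => ?_⟩
  by_cases hx : x = z0
  · rw [if_pos hx, hx, ← hNroot, hsum, hcard, hcardZ z0 hz0]
    norm_num
  · have hNsum := hsum (N x) p q
    rw [hNx x hx, Finset.sum_insert (T.par_notMem_children hx), ← hNx x hx, hcard] at hNsum
    rw [if_neg hx]
    by_cases hxZ : x ∈ Z
    · rw [if_pos (hparZ x hxZ hx), hcardZ x hxZ] at hNsum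
      rw [if_pos hxZ]
      push_cast at hNsum
      linarith
    · rw [if_neg hxZ, Finset.sum_congr rfl fun y hy => if_neg (hchZ x hxZ y hy), Finset.sum_const,
        nsmul_eq_mul]
      have h := hcard x
      rw [hNx x hx, Finset.card_insert_of_notMem (T.par_notMem_children hx)] at h
      rw [← h]
      push_cast
      ring

/-- The squares of the weights on a rooted tree are summable. -/
lemma Rooting.summable_weight_sq {V : Type} {G : SimpleGraph V} {z0 : V} (T : Rooting G z0)
    {Q : ℝ} {Z : Set V} {r a : ℝ}
    (hT : ∀ (p q : ℝ) (x : V), ∑ y ∈ T.children x, (if y ∈ Z then p else q) =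
      if x = z0 then 2 * p + (Q - 2) * q
      else if x ∈ Z then p + (Q - 2) * q else (Q - 1) * q)
    (hr : r ^ 2 < 1) (ha : (Q - 1) * a ^ 2 < 1) :
    Summable fun x => T.weight (fun y => if y ∈ Z then r else a) x ^ 2 := by
  set f := T.weight fun y => if y ∈ Z then r else a with hf
  obtain ⟨K, hK⟩ : ∃ K, K = 2 / (1 - r ^ 2) := ⟨_, rfl⟩
  have h1r : 0 < 1 - r ^ 2 := by linarith
  have hKr : K * (1 - r ^ 2) = 2 := by rw [hK]; field_simp
  have hK1 : 1 ≤ K := by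
    rw [hK, le_div_iff₀ h1r]
    nlinarith [sq_nonneg r]
  have hsum : Summable fun x => f x ^ 2 * if x ∈ Z then K else 1 := by
    refine T.summable_of_sum_children_le (θ := max ((Q - 1) * a ^ 2) ((1 + r ^ 2) / 2))
      (fun x => by split_ifs <;> positivity)
      (le_max_of_le_right (by positivity)) (max_lt ha (by linarith)) fun x hx => ?_
    have h : ∀ y ∈ T.children x, (f y ^ 2 * if y ∈ Z then K else 1) =
        f x ^ 2 * if y ∈ Z then r ^ 2 * K else a ^ 2 := fun y hy => by
      rw [hf, T.weight_child _ hy]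
      split_ifs <;> ring
    rw [Finset.sum_congr rfl h, ← Finset.mul_sum, hT, if_neg hx]
    split_ifs with hxZ
    · have h2 : (1 + r ^ 2) / 2 * K ≤ max ((Q - 1) * a ^ 2) ((1 + r ^ 2) / 2) * K :=
        mul_le_mul_of_nonneg_right (le_max_right _ _) (by linarith)
      have h3 : r ^ 2 * K + (Q - 2) * a ^ 2 ≤ (1 + r ^ 2) / 2 * K := by
        nlinarith [sq_nonneg a]
      calc f x ^ 2 * (r ^ 2 * K + (Q - 2) * a ^ 2)
          ≤ f x ^ 2 * (max ((Q - 1) * a ^ 2) ((1 + r ^ 2) / 2) * K) :=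
            mul_le_mul_of_nonneg_left (h3.trans h2) (sq_nonneg _)
        _ = _ := by ring
    · calc f x ^ 2 * ((Q - 1) * a ^ 2)
          ≤ f x ^ 2 * max ((Q - 1) * a ^ 2) ((1 + r ^ 2) / 2) :=
            mul_le_mul_of_nonneg_left (le_max_left _ _) (sq_nonneg _)
        _ = _ := by ring
  refine Summable.of_nonneg_of_le (fun x => sq_nonneg _) (fun x => ?_) hsum
  refine le_mul_of_one_le_right (sq_nonneg _) ?_
  split_ifs
  exacts [hK1, le_rfl]

/-- The diagonal entry at a vertex of `Z` of the resolvent of the tree with loops along `Z`. -/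
lemma entry_resR_add_proj {V : Type} {G : SimpleGraph V} {z0 : V} (T : Rooting G z0)
    {Q : ℝ} {Z : Set V} (hz0 : z0 ∈ Z)
    (hT : ∀ (p q : ℝ) (x : V), ∑ y ∈ T.children x, (if y ∈ Z then p else q) =
      if x = z0 then 2 * p + (Q - 2) * q
      else if x ∈ Z then p + (Q - 2) * q else (Q - 1) * q)
    {A : L2 V →L[ℂ] L2 V} (hA : IsAdjacencyOp G A)
    {P : Set V → (L2 V →L[ℂ] L2 V)} (hP : IsProjFamily P)
    {l r a : ℝ} (hu : IsUnit ((l : ℂ) • (1 : L2 V →L[ℂ] L2 V) - (A + P Z)))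
    (hr0 : 0 < r) (ha0 : 0 < a) (hr1 : r < 1) (ha : (Q - 1) * a ^ 2 < 1)
    (hal : 1 / a + (Q - 1) * a = l) (hrl : 1 / r + r = l - 1 - (Q - 2) * a) :
    (entry (ResR (A + P Z) l) z0 z0).re = (1 / r - r)⁻¹ := by
  set g : V → ℝ := fun y => if y ∈ Z then r else a with hg
  have hmem : Memℓp (fun x => (T.weight g x : ℂ)) 2 := by
    refine memℓp_gen ?_
    have := T.summable_weight_sq hT ((sq_lt_one_iff₀ hr0.le).2 hr1) ha
    simpa using this
  let f : L2 V := ⟨_, hmem⟩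
  have hfx : ∀ x, (f : ∀ _ : V, ℂ) x = (T.weight g x : ℂ) := fun _ => rfl
  have hchild : ∀ x, ∑ y ∈ T.children x, (f : ∀ _ : V, ℂ) y =
      ((if x = z0 then 2 * r + (Q - 2) * a
      else if x ∈ Z then r + (Q - 2) * a else (Q - 1) * a) * T.weight g x : ℝ) := by
    intro x
    rw [← hT, Finset.sum_mul, Complex.ofReal_sum]
    refine Finset.sum_congr rfl fun y hy => ?_
    rw [hfx, T.weight_child _ hy]
  have hc : 0 < 1 / r - r := by
    have : 1 < 1 / r := by rw [lt_div_iff₀ hr0]; linarith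
    linarith
  have hpar : ∀ x, x ≠ z0 → T.weight g (T.par x) = (1 / g x) * T.weight g x := by
    intro x hx
    have hgx : g x ≠ 0 := by
      rw [hg]
      dsimp only
      split_ifs
      exacts [hr0.ne', ha0.ne']
    rw [T.weight_child g (T.par_mem x hx)]
    field_simp
  have hAf : ∀ x, (A f : ∀ _ : V, ℂ) x =
      ∑ y ∈ T.children x, (f : ∀ _ : V, ℂ) y + if x = z0 then 0 else f (T.par x) := by
    intro x
    have h := hasSum_entry A f x
    simp only [hA x] at h
    exact h.unique (T.hasSum_adj _ x)
  have hreal : ∀ x, l * T.weight g x - ((if x = z0 then 2 * r + (Q - 2) * a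
      else if x ∈ Z then r + (Q - 2) * a else (Q - 1) * a) * T.weight g x +
      (if x = z0 then 0 else T.weight g (T.par x)) + if x ∈ Z then T.weight g x else 0) =
      (1 / r - r) * if x = z0 then 1 else 0 := by
    intro x
    by_cases hx : x = z0
    · rw [if_pos hx, if_pos hx, if_pos hx, hx, if_pos hz0, T.weight_root]
      linarith
    · rw [if_neg hx, if_neg hx, if_neg hx, hpar x hx]
      by_cases hxZ : x ∈ Z
      · have hgx : g x = r := if_pos hxZ
        rw [if_pos hxZ, if_pos hxZ, hgx]
        linear_combination (-T.weight g x) * hrl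
      · have hgx : g x = a := if_neg hxZ
        rw [if_neg hxZ, if_neg hxZ, hgx]
        linear_combination (-T.weight g x) * hal
  have hdelta : ∀ x, (delta z0 : ∀ _ : V, ℂ) x = if x = z0 then 1 else 0 := by
    intro x
    rw [delta, lp.single_apply, Pi.single_apply]
  have hBf : ((l : ℂ) • (1 : L2 V →L[ℂ] L2 V) - (A + P Z)) f =
      ((1 / r - r : ℝ) : ℂ) • delta z0 := by
    ext x
    have h1 : (((l : ℂ) • (1 : L2 V →L[ℂ] L2 V) - (A + P Z)) f : ∀ _ : V, ℂ) x =
        l * (f : ∀ _ : V, ℂ) x - ((A f : ∀ _ : V, ℂ) x + (P Z f : ∀ _ : V, ℂ) x) := rfl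
    have h2 : (((1 / r - r : ℝ) : ℂ) • delta z0 : L2 V) x =
        ((1 / r - r : ℝ) : ℂ) * (delta z0 : ∀ _ : V, ℂ) x := rfl
    have h3 := congrArg (fun t : ℝ => (t : ℂ)) (hreal x)
    rw [h1, h2, hdelta, hAf, hchild, hP, hfx, hfx]
    split_ifs at h3 ⊢ <;> push_cast at h3 ⊢ <;> exact h3
  have hres : ResR (A + P Z) l (delta z0) = (((1 / r - r : ℝ) : ℂ))⁻¹ • f := by
    have hc' : ((1 / r - r : ℝ) : ℂ) ≠ 0 := Complex.ofReal_ne_zero.2 hc.ne'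
    have h1 : ResR (A + P Z) l (((l : ℂ) • (1 : L2 V →L[ℂ] L2 V) - (A + P Z)) f) = f :=
      congrArg (fun B : L2 V →L[ℂ] L2 V => B f) (Ring.inverse_mul_cancel _ hu)
    rw [hBf, map_smul] at h1
    rw [← h1, smul_smul, inv_mul_cancel₀ hc', one_smul]
  have hentry : entry (ResR (A + P Z) l) z0 z0 =
      (((1 / r - r : ℝ) : ℂ))⁻¹ * (f : ∀ _ : V, ℂ) z0 := by
    rw [entry, hres]
    rfl
  rw [hentry, hfx, T.weight_root, ← Complex.ofReal_inv, ← Complex.ofReal_mul, Complex.ofReal_re,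
    mul_one]


/-- The energy of the effective line: the diagonal term obtained by eliminating the branches that
hang off a two-sided geodesic in the tree of degree `q`. -/
def effectiveEnergy (q l : ℝ) : ℝ :=
  l - 1 - (q - 2) * (2 / (l + √(l ^ 2 - 4 * (q - 1))))

lemma effectiveEnergy_facts {q s : ℝ} (hq3 : 3 ≤ q) (hq7 : q ≤ 7)
    (hs : s = (3 - √5) * q / 2 + √5) :
    0 < s ∧ 4 * (q - 1) < s ^ 2 ∧ effectiveEnergy q s = 2 ∧
      (∀ l, s < l → 2 < effectiveEnergy q l) ∧ ContinuousAt (effectiveEnergy q) s := by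
  have h5 : √5 ^ 2 = 5 := Real.sq_sqrt (by norm_num)
  have h50 : 0 ≤ √5 := Real.sqrt_nonneg 5
  have h5lt : √5 < 2.25 := by nlinarith
  have h5gt : 2.23 < √5 := by nlinarith
  have hd : 0 < (3 + √5) / 2 - (q - 1) * ((3 - √5) / 2) := by nlinarith
  have hsq : s ^ 2 - 4 * (q - 1) = ((3 + √5) / 2 - (q - 1) * ((3 - √5) / 2)) ^ 2 := by
    rw [hs]
    linear_combination (1 - q) * h5
  have hroot : √(s ^ 2 - 4 * (q - 1)) = (3 + √5) / 2 - (q - 1) * ((3 - √5) / 2) := by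
    rw [hsq, Real.sqrt_sq hd.le]
  have hsum : s + √(s ^ 2 - 4 * (q - 1)) = 3 + √5 := by
    rw [hroot, hs]
    ring
  have hs0 : 0 < s := by
    rw [hs]
    nlinarith
  have heff : effectiveEnergy q s = 2 := by
    have : 2 / (3 + √5) = (3 - √5) / 2 := by
      rw [div_eq_div_iff (by positivity) (by norm_num)]
      linarith
    rw [effectiveEnergy, hsum, this, hs]
    ring
  refine ⟨hs0, ?_, heff, fun l hl => ?_, ?_⟩
  · have := pow_pos hd 2
    linarith
  · rw [← heff, effectiveEnergy, effectiveEnergy]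
    have h1 : s + √(s ^ 2 - 4 * (q - 1)) ≤ l + √(l ^ 2 - 4 * (q - 1)) := by gcongr
    have h2 : 2 / (l + √(l ^ 2 - 4 * (q - 1))) ≤ 2 / (s + √(s ^ 2 - 4 * (q - 1))) :=
      div_le_div_of_nonneg_left (by norm_num) (by positivity) h1
    have h3 := mul_le_mul_of_nonneg_left h2 (by linarith : 0 ≤ q - 2)
    linarith
  · unfold effectiveEnergy
    have hne : s + √(s ^ 2 - 4 * (q - 1)) ≠ 0 := by positivity
    fun_prop (disch := assumption)

/-- **Theorem 4.1.** For `3 ≤ Q ≤ 7` and `λ* = ‖A_{𝔾^{Q,2}}‖ = (3−√5)Q/2 + √5`: for every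
real `λ > λ*` the operator `I_{ℓ²(Z)} − S(λ)` is invertible (witnessed by its corner
inverse `M`) and `R_{A_{𝔾^{Q,2}}}(λ) = R_A(λ)[I + P_{ℓ²(Z)}(I_{ℓ²(Z)} − S(λ))⁻¹ P_{ℓ²(Z)}
R_A(λ)]`; moreover `A_{𝔾^{Q,2}}` is recurrent: the diagonal matrix entry of the resolvent
at a vertex `0 ∈ Z` tends to `+∞` as `λ ↓ λ*`. -/
theorem resolvent_and_recurrence_GQ2 (Q : ℕ) (hQ3 : 3 ≤ Q) (hQ7 : Q ≤ 7)
    {V : Type} (G : SimpleGraph V) (hG : IsCayleyTree G Q)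
    (A : L2 V →L[ℂ] L2 V) (hA : IsAdjacencyOp G A) (hsa : IsSelfAdjoint A)
    (P : Set V → (L2 V →L[ℂ] L2 V)) (hP : IsProjFamily P)
    (Z : Set V) (hZ : IsRegularSubtree G Z 2) (z0 : V) (hz0 : z0 ∈ Z)
    (lamstar : ℝ) (hls : lamstar = (3 - Real.sqrt 5) * (Q : ℝ) / 2 + Real.sqrt 5)
    (hnorm : ‖A + P Z‖ = lamstar) :
    (∀ l : ℝ, lamstar < l →
      ∃ M : L2 V →L[ℂ] L2 V, IsCornerInverse (P Z) M (ResR A l) ∧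
        ResR (A + P Z) l =
          ResR A l ∘L ((1 : L2 V →L[ℂ] L2 V) + M ∘L ResR A l))
    ∧ Tendsto (fun l : ℝ => (entry (ResR (A + P Z) l) z0 z0).re)
        (𝓝[>] lamstar) atTop := by
  have hPnn := hP.nonneg Z
  have hunit : ∀ l : ℝ, lamstar < l → IsUnit ((l : ℂ) • (1 : L2 V →L[ℂ] L2 V) - A) ∧
      IsUnit ((l : ℂ) • (1 : L2 V →L[ℂ] L2 V) - (A + P Z)) := fun l hl =>
    isUnit_smul_one_sub_of_norm_add_lt hsa hPnn (by rwa [hnorm])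
  refine ⟨fun l hl => ?_, ?_⟩
  · obtain ⟨h1, h2⟩ := hunit l hl
    rw [← sub_sub] at h2
    obtain ⟨M, hM, hMres⟩ := exists_cornerInverse_of_isUnit (hP.mul_self Z) h1 h2
    refine ⟨M, hM, ?_⟩
    rw [ResR, Res, ← sub_sub]
    exact hMres
  · obtain ⟨T, hT⟩ := hG.exists_rooting hQ3 hZ hz0
    have hq3 : (3 : ℝ) ≤ Q := by exact_mod_cast hQ3
    have hq7 : (Q : ℝ) ≤ 7 := by exact_mod_cast hQ7
    obtain ⟨hs0, hsq, heff, hgt, hcont⟩ := effectiveEnergy_facts hq3 hq7 hls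
    have hentry : ∀ l ∈ Ioi lamstar, (√(effectiveEnergy Q l ^ 2 - 4 * 1))⁻¹ =
        (entry (ResR (A + P Z) l) z0 z0).re := by
      intro l hl
      have hl0 : 0 < l := hs0.trans hl
      have hl2 : 4 * ((Q : ℝ) - 1) < l ^ 2 := hsq.trans (pow_lt_pow_left₀ hl hs0.le two_ne_zero)
      have hm := hgt l hl
      obtain ⟨ha0, ha1, hal, -⟩ := quadratic_root hl0 hl2
      obtain ⟨hr0, hr1, hrl, hr⟩ := quadratic_root (D := 1) (m := effectiveEnergy Q l)
        (by linarith) (by nlinarith)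
      rw [← hr, one_mul]
      rw [one_mul] at hr1 hrl
      exact (entry_resR_add_proj T hz0 hT hA hP (hunit l hl).2 hr0 ha0
        ((sq_lt_one_iff₀ hr0.le).1 hr1) ha1 hal hrl).symm
    refine Tendsto.congr' (eventually_nhdsWithin_of_forall hentry) ?_
    refine tendsto_inv_nhdsGT_zero.comp (tendsto_nhdsWithin_iff.2 ⟨?_, ?_⟩)
    · have h : ContinuousAt (fun l => √(effectiveEnergy Q l ^ 2 - 4 * 1)) lamstar := by fun_prop
      have h2 := h.tendsto
      rw [heff, show (2 : ℝ) ^ 2 - 4 * 1 = 0 by norm_num, Real.sqrt_zero] at h2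
      exact h2.mono_left nhdsWithin_le_nhds
    · refine eventually_nhdsWithin_of_forall fun l hl => Real.sqrt_pos.2 ?_
      have := hgt l hl
      nlinarith
end
end
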